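/- Let B be a subset of ℝ that is simultaneously a Bernstein set and a subgroup of (ℝ, +). Let U₁, …, Uₙ each be a finite union of cosets of B, and let t₁, …, tₙ ∈ ℝ. Then the set U = (U₁ + t₁) ∪ (U₂ + t₂) ∪ ⋯ ∪ (Uₙ + tₙ) is not Lebesgue measurable and does not have the Baire property in ℝ. -/

import Mathlib

open MeasureTheory

/-- A Bernstein set: a set `B ⊆ ℝ` such that every uncountable closed subset
`F` of `ℝ` meets both `B` and its complement. -/
def IsBernstein (B : Set ℝ) : Prop :=
  ∀ F : Set ℝ, IsClosed F → ¬F.Countable → (F ∩ B).Nonempty ∧ (F ∩ Bᶜ).Nonempty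

/-- `U` is a finite union of cosets (translates) of `B`. -/
def FinUnionCosets (B U : Set ℝ) : Prop :=
  ∃ (m : ℕ) (x : Fin (m + 1) → ℝ), U = ⋃ i, (fun b => b + x i) '' B

/-- A set `A ⊆ ℝ` has the Baire property if `A = O ∆ M` for some open `O`
and meager `M`. -/
def HasBaireProperty (A : Set ℝ) : Prop :=
  ∃ O M : Set ℝ, IsOpen O ∧ IsMeagre M ∧ A = symmDiff O M

theorem IsBernstein.compl {B : Set ℝ} (hB : IsBernstein B) : IsBernstein Bᶜ := fun F hF hunc =>
  ⟨(hB F hF hunc).2, by simpa using (hB F hF hunc).1⟩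

theorem AddSubgroup.eq_top_of_finite_quotient_real (G : AddSubgroup ℝ) [Finite (ℝ ⧸ G)] :
    G = ⊤ := by
  have hG : (G.index : ℝ) ≠ 0 := by
    exact_mod_cast (AddSubgroup.finiteIndex_iff_finite_quotient.2 ‹_›).index_ne_zero
  refine eq_top_iff.2 fun x _ => ?_
  have h := G.nsmul_index_mem (x / G.index)
  rwa [nsmul_eq_mul, mul_div_cancel₀ _ hG] at h

/-- A nonempty finite union of cosets of a Bernstein subgroup is again a Bernstein set: a subgroup
of finite index in the divisible group `ℝ` is everything, so such a union misses some coset. -/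
theorem IsBernstein.iUnion_cosets {ι : Type*} [Finite ι] [Nonempty ι] {G : AddSubgroup ℝ}
    (hG : IsBernstein (G : Set ℝ)) (y : ι → ℝ) : IsBernstein {a | ∃ i, a - y i ∈ G} := by
  have meets_coset (F : Set ℝ) (hF : IsClosed F) (hunc : ¬F.Countable) (z : ℝ) :
      ∃ a ∈ F, a - z ∈ G := by
    obtain ⟨b, hbF, hbG⟩ := (hG ((· + z) ⁻¹' F) (hF.preimage (continuous_add_const z))
      fun h => hunc <| by
        simpa [Set.image_preimage_eq F (add_right_surjective z)] using h.image (· + z)).1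
    exact ⟨b + z, hbF, by simpa using hbG⟩
  have hne : G ≠ ⊤ := by
    rintro rfl
    obtain ⟨x, -, hx⟩ := (hG Set.univ isClosed_univ Set.not_countable_univ).2
    exact hx trivial
  obtain ⟨z, hz⟩ : ∃ z, ∀ i, z - y i ∉ G := by
    by_contra! h
    have hsurj : Function.Surjective fun i => (y i : ℝ ⧸ G) := by
      rintro ⟨z⟩
      obtain ⟨i, hi⟩ := h z
      exact ⟨i, QuotientAddGroup.eq.2 (by simpa [neg_add_eq_sub] using hi)⟩
    have := Finite.of_surjective _ hsurj
    exact hne G.eq_top_of_finite_quotient_real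
  intro F hF hunc
  constructor
  · obtain ⟨i⟩ := ‹Nonempty ι›
    obtain ⟨a, haF, ha⟩ := meets_coset F hF hunc (y i)
    exact ⟨a, haF, i, ha⟩
  · obtain ⟨a, haF, ha⟩ := meets_coset F hF hunc z
    refine ⟨a, haF, ?_⟩
    rintro ⟨i, hi⟩
    exact hz i (by simpa using G.sub_mem hi ha)

theorem IsBernstein.volume_eq_zero {B : Set ℝ} (hB : IsBernstein B)
    (hm : NullMeasurableSet B volume) : volume B = 0 := by
  obtain ⟨T, hTB, hT, hTe⟩ := hm.exists_measurable_subset_ae_eq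
  rw [← measure_congr hTe]
  by_contra hpos
  obtain ⟨K, hKT, hK, hKpos⟩ := hT.exists_lt_isCompact (pos_iff_ne_zero.2 hpos)
  obtain ⟨x, hxK, hxB⟩ := (hB K hK.isClosed fun h => hKpos.ne' (h.measure_zero volume)).2
  exact hxB (hTB (hKT hxK))

theorem IsBernstein.not_nullMeasurableSet {B : Set ℝ} (hB : IsBernstein B) :
    ¬NullMeasurableSet B volume := fun hm => by
  have h := measure_union_null (hB.volume_eq_zero hm) (hB.compl.volume_eq_zero hm.compl)
  simp at h

theorem Set.Countable.isMeagre_real {s : Set ℝ} (hs : s.Countable) : IsMeagre s := by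
  rw [← Set.biUnion_of_singleton s]
  exact isMeagre_biUnion hs fun x _ => IsNowhereDense.isMeagre (by simp [IsNowhereDense])

theorem MeasurableSet.exists_isClosed_subset_not_countable {s : Set ℝ} (hs : MeasurableSet s)
    (hunc : ¬s.Countable) : ∃ F ⊆ s, IsClosed F ∧ ¬F.Countable := by
  obtain ⟨f, hfs, hf, hinj⟩ :
      ∃ f : (ℕ → Bool) → ℝ, Set.range f ⊆ s ∧ Continuous f ∧ Function.Injective f := by
    obtain ⟨t, hle, ht, hclosed, -⟩ := hs.isClopenable
    obtain ⟨f, hfs, hf, hinj⟩ :=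
      @IsClosed.exists_nat_bool_injection_of_not_countable ℝ t ht s hclosed hunc
    exact ⟨f, hfs, continuous_le_rng hle hf, hinj⟩
  refine ⟨Set.range f, hfs, (isCompact_range hf).isClosed, fun h => ?_⟩
  have hcard : Cardinal.mk (ℕ → Bool) = Cardinal.continuum := by simp
  have := h.to_subtype
  have : Countable (ℕ → Bool) := (Set.rangeFactorization_injective.2 hinj).countable
  exact Cardinal.aleph0_lt_continuum.not_ge (hcard ▸ Cardinal.mk_le_aleph0)

theorem IsOpen.exists_isClosed_subset_diff_not_countable {O M : Set ℝ} (hO : IsOpen O)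
    (hne : O.Nonempty) (hM : IsMeagre M) : ∃ F ⊆ O \ M, IsClosed F ∧ ¬F.Countable := by
  obtain ⟨t, htM, ht, hdense⟩ := mem_residual.1 hM
  have htm : IsMeagre tᶜ := by
    simpa [IsMeagre] using residual_of_dense_Gδ ht hdense
  have hunc : ¬(O ∩ t).Countable := fun h => not_isMeagre_of_isOpen hO hne <|
    (h.isMeagre_real.union htm).mono fun x hx => by
      by_cases hxt : x ∈ t
      exacts [Or.inl ⟨hx, hxt⟩, Or.inr hxt]
  obtain ⟨F, hF, h⟩ :=
    (hO.measurableSet.inter ht.measurableSet).exists_isClosed_subset_not_countable hunc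
  exact ⟨F, hF.trans (Set.inter_subset_inter_right O htM), h⟩

theorem IsBernstein.not_hasBaireProperty {B : Set ℝ} (hB : IsBernstein B) :
    ¬HasBaireProperty B := by
  rintro ⟨O, M, hO, hM, rfl⟩
  rcases O.eq_empty_or_nonempty with rfl | hne
  · obtain ⟨F, hF, hcl, hunc⟩ :=
      isOpen_univ.exists_isClosed_subset_diff_not_countable Set.univ_nonempty hM
    obtain ⟨x, hxF, hx⟩ := (hB F hcl hunc).1
    exact (hF hxF).2 (by simpa [Set.mem_symmDiff] using hx)
  · obtain ⟨F, hF, hcl, hunc⟩ := hO.exists_isClosed_subset_diff_not_countable hne hM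
    obtain ⟨x, hxF, hx⟩ := (hB F hcl hunc).2
    exact hx (Or.inl (hF hxF))

theorem stmt_9 (B : Set ℝ) (hB : IsBernstein B)
    (hsub : ∃ G : AddSubgroup ℝ, (G : Set ℝ) = B)
    (n : ℕ) (U : Fin (n + 1) → Set ℝ) (hU : ∀ k, FinUnionCosets B (U k))
    (t : Fin (n + 1) → ℝ) :
    ¬NullMeasurableSet (⋃ k, (fun a => a + t k) '' U k) volume ∧
    ¬HasBaireProperty (⋃ k, (fun a => a + t k) '' U k) := by
  obtain ⟨G, rfl⟩ := hsub
  choose m x hx using hU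
  have hU' : (⋃ k, (fun a => a + t k) '' U k) =
      {a | ∃ p : Σ k, Fin (m k + 1), a - (x p.1 p.2 + t p.1) ∈ G} := by
    ext a
    simp only [hx, Set.mem_iUnion, Set.mem_image, Set.mem_ofPred_eq, SetLike.mem_coe, Sigma.exists]
    constructor
    · rintro ⟨k, _, ⟨i, b, hb, rfl⟩, rfl⟩
      exact ⟨k, i, by simpa [add_assoc] using hb⟩
    · rintro ⟨k, i, h⟩
      exact ⟨k, _, ⟨i, _, h, rfl⟩, by ring⟩
  rw [hU']
  have hBernstein := hB.iUnion_cosets fun p : Σ k, Fin (m k + 1) => x p.1 p.2 + t p.1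
  exact ⟨hBernstein.not_nullMeasurableSet, hBernstein.not_hasBaireProperty⟩
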